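/- arXiv:1602.06174 — 3 statements merged into one kernel-verified Lean document; each statement's English description precedes it below -/
import Mathlib

section
/- Let B, c, d be positive integers and let I be a finite index set of packet requests r_i = (a_i, b_i, t_i) with natural numbers a_i < b_i, t_i ≥ 0 and b_i − a_i ≤ d. Suppose (p_i)_{i∈I} is a family of paths in the space-time grid such that each p_i starts at vertex (a_i, t_i) and ends at a vertex in the row of b_i, every store edge lies on at most B of the paths, and every forward edge lies on at most c of the paths. Then there exists a subset I′ ⊆ I with |I′| ≥ (c / (2(B + c))) · |I| and a family of paths (q_i)_{i∈I′} such that each q_i starts at (a_i, t_i), ends at a vertex in the row of b_i, has length at most 2d and at most the length of p_i, every store edge lies on at most B of the paths (q_i)_{i∈I′}, and every forward edge lies on at most c of them. -/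
/-- A step in the space-time grid: a *store* edge `(v,t) → (v,t+1)` or a
*forward* edge `(v,t) → (v+1,t+1)`. -/
def GridStep (u v : ℕ × ℕ) : Prop :=
  v = (u.1, u.2 + 1) ∨ v = (u.1 + 1, u.2 + 1)

/-- The (directed) edges of a path given as a list of vertices. -/
def pathEdges (L : List (ℕ × ℕ)) : List ((ℕ × ℕ) × (ℕ × ℕ)) := L.zip L.tail

/-- `L` is a path in the space-time grid serving the request with source `a`,
destination `b` and arrival time `t₀`: it starts at the vertex `(a, t₀)` and
ends at a vertex in the row of `b`. -/
def ServesRequest (a b t₀ : ℕ) (L : List (ℕ × ℕ)) : Prop :=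
  L.Chain' GridStep ∧ L.head? = some (a, t₀) ∧ ∃ t, L.getLast? = some (b, t)

/-- The path occupying the vertex `(x k, t + k)` after `k` steps, for `k ≤ n`. -/
def timedPath (t n : ℕ) (x : ℕ → ℕ) : List (ℕ × ℕ) :=
  (List.range (n + 1)).map fun k => (x k, t + k)

theorem length_timedPath (t n : ℕ) (x : ℕ → ℕ) : (timedPath t n x).length = n + 1 := by
  simp [timedPath]

theorem mem_pathEdges_iff {L : List (ℕ × ℕ)} {u w : ℕ × ℕ} :
    (u, w) ∈ pathEdges L ↔ ∃ k, L[k]? = some u ∧ L[k + 1]? = some w := by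
  simp only [pathEdges, List.mem_iff_getElem?, List.getElem?_zip_eq_some, List.getElem?_tail]

theorem mem_pathEdges_timedPath {t n : ℕ} {x : ℕ → ℕ} {v τ w σ : ℕ} :
    ((v, τ), (w, σ)) ∈ pathEdges (timedPath t n x) ↔
      ∃ k < n, x k = v ∧ t + k = τ ∧ x (k + 1) = w ∧ τ + 1 = σ := by
  rw [mem_pathEdges_iff]
  simp only [timedPath, List.getElem?_map, Option.map_eq_some_iff,
    List.getElem?_eq_some_iff, List.length_range, List.getElem_range, Prod.mk.injEq]
  constructor
  · rintro ⟨k, ⟨_, ⟨_, rfl⟩, h1, h2⟩, _, ⟨h, rfl⟩, h3, h4⟩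
    exact ⟨k, by omega, h1, h2, h3, by omega⟩
  · rintro ⟨k, hk, h1, h2, h3, h4⟩
    exact ⟨k, ⟨k, ⟨by omega, rfl⟩, h1, h2⟩, k + 1, ⟨by omega, rfl⟩, h3, by omega⟩

theorem servesRequest_timedPath {a b t n : ℕ} {x : ℕ → ℕ} (h0 : x 0 = a) (hn : x n = b)
    (hstep : ∀ k < n, x (k + 1) = x k ∨ x (k + 1) = x k + 1) :
    ServesRequest a b t (timedPath t n x) := by
  refine ⟨?_, ?_, t + n, ?_⟩
  · refine List.isChain_iff_getElem.2 fun k hk => ?_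
    rw [length_timedPath] at hk
    rcases hstep k (by omega) with h | h
    · left; simp [timedPath, h]; omega
    · right; simp [timedPath, h]; omega
  · simp [timedPath, List.head?_range, h0]
  · simp [timedPath, List.getLast?_range, hn]

theorem ServesRequest.exists_eq_timedPath {a b t : ℕ} {L : List (ℕ × ℕ)}
    (h : ServesRequest a b t L) :
    ∃ (n : ℕ) (x : ℕ → ℕ), L = timedPath t n x ∧ x 0 = a ∧ x n = b ∧
      ∀ k < n, x (k + 1) = x k ∨ x (k + 1) = x k + 1 := by
  obtain ⟨hchain, hhead, s, hlast⟩ := h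
  have hpos : 0 < L.length := by
    rcases L with _ | ⟨_, _⟩
    · simp at hhead
    · simp
  have hstep : ∀ k (hk : k + 1 < L.length), GridStep L[k] L[k + 1] :=
    fun k hk => List.isChain_iff_getElem.1 hchain k hk
  have hzero : L[0] = (a, t) := by
    rw [List.head?_eq_getElem?, List.getElem?_eq_getElem hpos] at hhead
    exact Option.some.inj hhead
  have hend : L[L.length - 1] = (b, s) := by
    rw [List.getLast?_eq_getElem?, List.getElem?_eq_getElem (by omega)] at hlast
    exact Option.some.inj hlast
  have htime : ∀ k (hk : k < L.length), L[k].2 = t + k := by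
    intro k
    induction k with
    | zero => intro _; simp [hzero]
    | succ k ih =>
      intro hk
      have := ih (by omega)
      rcases hstep k hk with h | h <;> rw [h] <;> simp only [this] <;> omega
  have hget : ∀ k (hk : k < L.length), (L.getD k (0, 0)) = L[k] := by
    intro k hk
    simp [List.getD_eq_getElem?_getD, hk]
  refine ⟨L.length - 1, fun k => (L.getD k (0, 0)).1, ?_, ?_, ?_, ?_⟩
  · refine List.ext_getElem (by rw [length_timedPath]; omega) fun k h1 h2 => ?_
    ext
    · simp [timedPath, h1]
    · simp [timedPath, htime k h1]
  · simp only [hget 0 hpos, hzero]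
  · simp only [hget (L.length - 1) (by omega), hend]
  · intro k hk
    simp only [hget k (by omega), hget (k + 1) (by omega)]
    rcases hstep k (by omega) with h | h
    · left; rw [h]
    · right; rw [h]

theorem slow_growth {x : ℕ → ℕ} {n : ℕ}
    (hstep : ∀ k < n, x (k + 1) = x k ∨ x (k + 1) = x k + 1) (j : ℕ) :
    ∀ k, j ≤ k → k ≤ n → x j ≤ x k ∧ x k ≤ x j + (k - j) := by
  intro k hjk
  induction k, hjk using Nat.le_induction with
  | base => intro _; simp
  | succ k hjk ih =>
    intro hk
    have h1 := ih (by omega)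
    rcases hstep k (by omega) with h | h <;> omega

/-- If all fibers of `f` on `S` have at most `N` elements, keeping at most `c ≤ N` elements of
each fiber retains at least a `c / N` fraction of `S`. -/
theorem exists_subset_fiber_card_le {ι κ : Type*} [DecidableEq ι] [DecidableEq κ]
    (S : Finset ι) (f : ι → κ) {c N : ℕ} (hcN : c ≤ N)
    (hN : ∀ y, (S.filter fun i => f i = y).card ≤ N) :
    ∃ S' ⊆ S, (∀ y, (S'.filter fun i => f i = y).card ≤ c) ∧ c * S.card ≤ N * S'.card := by
  have hchoice : ∀ y, ∃ U ⊆ S.filter (fun i => f i = y),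
      U.card = min c (S.filter fun i => f i = y).card :=
    fun y => Finset.exists_subset_card_eq (min_le_right _ _)
  choose U hU hcard using hchoice
  have hfib : ∀ y, (S.filter fun i => i ∈ U (f i)).filter (fun i => f i = y) = U y := by
    intro y
    ext i
    simp only [Finset.mem_filter]
    constructor
    · rintro ⟨⟨_, h⟩, rfl⟩
      exact h
    · intro h
      have := Finset.mem_filter.1 (hU y h)
      exact ⟨⟨this.1, this.2 ▸ h⟩, this.2⟩
  refine ⟨S.filter fun i => i ∈ U (f i), Finset.filter_subset _ _, ?_, ?_⟩
  · intro y
    rw [hfib, hcard]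
    exact min_le_left _ _
  · rw [Finset.card_eq_sum_card_image f S,
      Finset.card_eq_sum_card_fiberwise (f := f) (t := S.image f)
        (s := S.filter fun i => i ∈ U (f i))
        (fun i hi => Finset.mem_image_of_mem f (Finset.mem_filter.1 hi).1),
      Finset.mul_sum, Finset.mul_sum]
    refine Finset.sum_le_sum fun y _ => ?_
    rw [hfib, hcard]
    rcases le_total c (S.filter fun i => f i = y).card with h | h
    · rw [min_eq_left h, mul_comm N]
      exact Nat.mul_le_mul_left _ (hN y)
    · rw [min_eq_right h]
      exact Nat.mul_le_mul_right _ hcN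

theorem exists_parity_class {ι : Type*} [Fintype ι] (g : ι → ℕ) :
    ∃ r, Fintype.card ι ≤ 2 * (Finset.univ.filter fun i => g i % 2 = r).card := by
  have h := Finset.card_filter_add_card_filter_not (s := (Finset.univ : Finset ι))
    (fun i => g i % 2 = 0)
  rw [Finset.card_univ] at h
  simp only [Nat.mod_two_not_eq_zero] at h
  by_cases h0 : Fintype.card ι ≤ 2 * (Finset.univ.filter fun i => g i % 2 = 0).card
  · exact ⟨0, h0⟩
  · exact ⟨1, by omega⟩

/-- Follow `x` for `m` steps and then move forward only. -/
def straighten (m : ℕ) (x : ℕ → ℕ) (k : ℕ) : ℕ := if k ≤ m then x k else x m + (k - m)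

/-- The number of steps `straighten m x` needs to reach row `b`, when the original path
takes `n` steps. -/
def straightLength (m n b : ℕ) (x : ℕ → ℕ) : ℕ := if n ≤ m then n else m + (b - x m)

section Straighten

variable {m n a b d : ℕ} {x : ℕ → ℕ}

theorem straighten_step
    {k : ℕ} (hk : k < straightLength m n b x) :
    (k < m ∧ k < n ∧ straighten m x k = x k ∧ straighten m x (k + 1) = x (k + 1)) ∨
    (m ≤ k ∧ m < n ∧ k - m < b - x m ∧ straighten m x k = x m + (k - m) ∧
      straighten m x (k + 1) = straighten m x k + 1) := by
  unfold straightLength at hk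
  unfold straighten
  by_cases hkm : k < m
  · left
    rw [if_pos (by omega), if_pos (by omega)]
    split_ifs at hk <;> omega
  · right
    split_ifs at hk with h
    · omega
    · rw [if_neg (by omega : ¬ k + 1 ≤ m)]
      rcases (by omega : k = m ∨ m < k) with rfl | h'
      · rw [if_pos le_rfl]; omega
      · rw [if_neg (by omega)]; omega

theorem servesRequest_straighten (t : ℕ) (h0 : x 0 = a) (hn : x n = b)
    (hstep : ∀ k < n, x (k + 1) = x k ∨ x (k + 1) = x k + 1) :
    ServesRequest a b t (timedPath t (straightLength m n b x) (straighten m x)) := by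
  refine servesRequest_timedPath (by simp [straighten, h0]) ?_ fun k hk => ?_
  · unfold straightLength straighten
    by_cases h : n ≤ m
    · simp [h, hn]
    · have := slow_growth hstep m n (by omega) le_rfl
      rw [if_neg h]
      split_ifs with h'
      · have h2 : b - x m = 0 := by omega
        rw [h2, add_zero]; omega
      · omega
  · rcases straighten_step hk with ⟨_, hkn, h1, h2⟩ | ⟨_, _, _, _, h2⟩
    · rw [h1, h2]; exact hstep k hkn
    · exact Or.inr h2

theorem straightLength_le (hn : x n = b)
    (hstep : ∀ k < n, x (k + 1) = x k ∨ x (k + 1) = x k + 1) :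
    straightLength m n b x ≤ n := by
  unfold straightLength
  split_ifs with h
  · exact le_rfl
  · have := slow_growth hstep m n (by omega) le_rfl
    omega

theorem dest_sub_le (h0 : x 0 = a) (hbd : b - a ≤ d)
    (hstep : ∀ k < n, x (k + 1) = x k ∨ x (k + 1) = x k + 1) (hmn : m < n) :
    b - x m ≤ d := by
  have := slow_growth hstep 0 m (by omega) (by omega)
  omega

end Straighten

/-- **Integral bounded path length lemma.**  If a family of paths serving requests of
source-destination distance at most `d` satisfies the buffer capacity `B` (store edges)
and the link capacity `c` (forward edges), then there is a subset `I'` of at least a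
`c / (2(B+c))` fraction of the requests together with a family of paths `(q i)` for the
requests of `I'`, each of length at most `2d` (and no longer than the original path),
again satisfying the capacity constraints. -/
theorem integral_bounded_path_length
    (B c d : ℕ) (hB : 0 < B) (hc : 0 < c) (hd : 0 < d)
    {ι : Type} [Fintype ι] [DecidableEq ι]
    (a b t : ι → ℕ)
    (hab : ∀ i, a i < b i) (hbd : ∀ i, b i - a i ≤ d)
    (p : ι → List (ℕ × ℕ))
    (hp : ∀ i, ServesRequest (a i) (b i) (t i) (p i))
    (hstore : ∀ v τ : ℕ,
      (Finset.univ.filter fun i => ((v, τ), (v, τ + 1)) ∈ pathEdges (p i)).card ≤ B)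
    (hfwd : ∀ v τ : ℕ,
      (Finset.univ.filter fun i => ((v, τ), (v + 1, τ + 1)) ∈ pathEdges (p i)).card ≤ c) :
    ∃ (I' : Finset ι) (q : ι → List (ℕ × ℕ)),
      (c : ℝ) / (2 * (B + c)) * Fintype.card ι ≤ I'.card ∧
      (∀ i ∈ I', ServesRequest (a i) (b i) (t i) (q i)) ∧
      (∀ i ∈ I', (q i).length - 1 ≤ 2 * d) ∧
      (∀ i ∈ I', (q i).length - 1 ≤ (p i).length - 1) ∧
      (∀ v τ : ℕ,
        (I'.filter fun i => ((v, τ), (v, τ + 1)) ∈ pathEdges (q i)).card ≤ B) ∧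
      (∀ v τ : ℕ,
        (I'.filter fun i => ((v, τ), (v + 1, τ + 1)) ∈ pathEdges (q i)).card ≤ c) := by
  choose n x hpx hx0 hxn hstep using fun i => (hp i).exists_eq_timedPath
  simp only [hpx, mem_pathEdges_timedPath, and_true] at hstore hfwd
  obtain ⟨m, hm⟩ : ∃ m : ι → ℕ, ∀ i, t i + m i = (t i / d + 1) * d :=
    ⟨fun i => (t i / d + 1) * d - t i, fun i =>
      Nat.add_sub_cancel' (by
        have := Nat.lt_mul_div_succ (t i) hd
        rw [mul_comm] at this
        exact this.le)⟩
  have hmd : ∀ i, m i ≤ d := by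
    intro i
    have h1 := hm i
    have h2 := Nat.div_mul_le_self (t i) d
    rw [add_mul] at h1
    omega
  -- Requests are classified by the parity of the slab of `d` time units they arrive in.
  obtain ⟨r, hr⟩ := exists_parity_class fun i => t i / d
  set C := Finset.univ.filter fun i => t i / d % 2 = r
  have hfiber : ∀ y : ℕ × ℕ, ((C.filter fun i => m i < n i).filter
      fun i => (x i (m i), t i + m i) = y).card ≤ B + c := by
    rintro ⟨v, τ⟩
    refine le_trans (Finset.card_le_card ?_)
      ((Finset.card_union_le _ _).trans (Nat.add_le_add (hstore v τ) (hfwd v τ)))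
    intro i hi
    simp only [Finset.mem_filter, Prod.mk.injEq] at hi
    obtain ⟨⟨_, hmn⟩, hv, hτ⟩ := hi
    simp only [Finset.mem_union, Finset.mem_filter, Finset.mem_univ, true_and]
    rcases hstep i (m i) hmn with h | h
    · exact Or.inl ⟨m i, hmn, hv, hτ, by omega⟩
    · exact Or.inr ⟨m i, hmn, hv, hτ, by omega⟩
  obtain ⟨S, hSsub, hSfiber, hScard⟩ := exists_subset_fiber_card_le
    (C.filter fun i => m i < n i) (fun i => (x i (m i), t i + m i))
    (Nat.le_add_left c B) hfiber
  have hmem : ∀ i ∈ (C.filter fun i => ¬ m i < n i) ∪ S,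
      t i / d % 2 = r ∧ (m i < n i → i ∈ S) := by
    intro i hi
    rcases Finset.mem_union.1 hi with h | h
    · have h := Finset.mem_filter.1 h
      exact ⟨(Finset.mem_filter.1 h.1).2, fun h' => absurd h' h.2⟩
    · exact ⟨(Finset.mem_filter.1 (Finset.mem_filter.1 (hSsub h)).1).2, fun _ => h⟩
  refine ⟨(C.filter fun i => ¬ m i < n i) ∪ S,
    fun i => timedPath (t i) (straightLength (m i) (n i) (b i) (x i)) (straighten (m i) (x i)),
    ?_, ?_, ?_, ?_, ?_, ?_⟩
  · have hdisj : Disjoint (C.filter fun i => ¬ m i < n i) S :=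
      (Finset.disjoint_filter_filter_not C C _).symm.mono_right hSsub
    have hsplit := Finset.card_filter_add_card_filter_not (s := C) (fun i => m i < n i)
    rw [Finset.card_union_of_disjoint hdisj]
    have key : c * Fintype.card ι ≤
        2 * (B + c) * ((C.filter fun i => ¬ m i < n i).card + S.card) := by
      rw [← hsplit] at hr
      nlinarith [Nat.mul_le_mul_left c hr,
        Nat.zero_le (B * (C.filter fun i => ¬ m i < n i).card)]
    have hpos : (0 : ℝ) < 2 * (B + c) := by positivity
    rw [div_mul_eq_mul_div, div_le_iff₀ hpos, mul_comm _ (2 * ((B : ℝ) + c))]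
    exact_mod_cast key
  · exact fun i _ => servesRequest_straighten (t i) (hx0 i) (hxn i) (hstep i)
  · intro i _
    rw [length_timedPath, Nat.add_sub_cancel]
    have := hmd i
    unfold straightLength
    split_ifs with h
    · omega
    · have := dest_sub_le (hx0 i) (hbd i) (hstep i) (not_le.1 h)
      omega
  · intro i _
    rw [hpx i, length_timedPath, length_timedPath, Nat.add_sub_cancel, Nat.add_sub_cancel]
    exact straightLength_le (hxn i) (hstep i)
  · intro v τ
    refine le_trans (Finset.card_le_card ?_) (hstore v τ)
    intro i hi
    simp only [Finset.mem_filter, mem_pathEdges_timedPath] at hi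
    obtain ⟨_, k, hk, h1, h2, h3, h4⟩ := hi
    refine Finset.mem_filter.2 ⟨Finset.mem_univ i, k, ?_⟩
    rcases straighten_step hk with h | h <;> omega
  · intro v τ
    -- An edge in a slab of parity `r` is only used by unmodified initial segments, an edge in a
    -- slab of the other parity only by diagonal segments.
    have hslab : ∀ i k, t i + k = τ → k < m i → τ / d = t i / d := by
      intro i k h1 h2
      have := hm i
      exact le_antisymm (Nat.lt_succ_iff.1 ((Nat.div_lt_iff_lt_mul hd).2
        (by rw [← Nat.add_one]; omega))) (Nat.div_le_div_right (by omega))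
    have hslab' : ∀ i k, t i + k = τ → m i ≤ k → k - m i < d → τ / d = t i / d + 1 := by
      intro i k h1 h2 h3
      have := hm i
      refine Nat.div_eq_of_lt_le (by omega) ?_
      rw [add_mul _ 1]
      omega
    by_cases hτ : τ / d % 2 = r
    · refine le_trans (Finset.card_le_card ?_) (hfwd v τ)
      intro i hi
      simp only [Finset.mem_filter, mem_pathEdges_timedPath] at hi
      obtain ⟨hi, k, hk, h1, h2, h3, h4⟩ := hi
      refine Finset.mem_filter.2 ⟨Finset.mem_univ i, k, ?_⟩
      rcases straighten_step hk with h | ⟨hmk, hmn, hkb, h⟩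
      · omega
      · have hb := dest_sub_le (hx0 i) (hbd i) (hstep i) hmn
        have := hslab' i k h2 hmk (by omega)
        have := (hmem i hi).1
        omega
    · refine le_trans (Finset.card_le_card ?_) (hSfiber (v - (τ - τ / d * d), τ / d * d))
      intro i hi
      simp only [Finset.mem_filter, mem_pathEdges_timedPath] at hi
      obtain ⟨hi, k, hk, h1, h2, h3, h4⟩ := hi
      rcases straighten_step hk with ⟨hkm, _⟩ | ⟨hmk, hmn, hkb, h5, h6⟩
      · have := hslab i k h2 hkm
        exact absurd (this ▸ (hmem i hi).1) hτ
      · have hb := dest_sub_le (hx0 i) (hbd i) (hstep i) hmn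
        have hT := hslab' i k h2 hmk (by omega)
        have := hm i
        refine Finset.mem_filter.2 ⟨(hmem i hi).2 hmn, ?_⟩
        rw [hT, ← this]
        ext <;> simp only
        omega
end

section
/- Let B, c, d be positive integers and let I be a finite index set of packet requests r_i = (a_i, b_i, t_i) with natural numbers a_i < b_i, t_i ≥ 0 and b_i − a_i ≤ d. Let F = (f_i)_{i∈I} be a fractional multi-commodity flow for these requests in the space-time grid, i.e., each f_i assigns nonnegative weights to finitely many paths serving request r_i with total weight |f_i| ≤ 1, and for every store edge the total weight over all i of paths containing that edge is at most B while for every forward edge it is at most c. Then there exists a fractional multi-commodity flow G = (g_i)_{i∈I} for the same requests, satisfying the same capacity constraints, in which every path carrying positive weight has length at most 2d, and whose throughput satisfies Σ_i |g_i| ≥ (c / (B + 2c)) · Σ_i |f_i|. -/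
/-- `f` is a fractional multi-commodity flow for the requests `(a i, b i, t i)`, `i : ι`,
in the space-time grid with buffer capacity `B` (store edges) and link capacity `c`
(forward edges): each `f i` is a finitely supported nonnegative weighting of paths
serving request `i`, of total weight at most `1`, and for every edge the cumulative
weight of the paths through that edge respects its capacity. -/
def IsFracMCF (B c : ℕ) {ι : Type} [Fintype ι] (a b t : ι → ℕ)
    (f : ι → (List (ℕ × ℕ) →₀ ℝ)) : Prop :=
  (∀ i P, 0 ≤ f i P) ∧
  (∀ i P, P ∈ (f i).support → ServesRequest (a i) (b i) (t i) P) ∧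
  (∀ i, ∑ P ∈ (f i).support, f i P ≤ 1) ∧
  (∀ v τ : ℕ, ∑ i, ∑ P ∈ (f i).support,
      (if ((v, τ), (v, τ + 1)) ∈ pathEdges P then f i P else 0) ≤ B) ∧
  (∀ v τ : ℕ, ∑ i, ∑ P ∈ (f i).support,
      (if ((v, τ), (v + 1, τ + 1)) ∈ pathEdges P then f i P else 0) ≤ c)

/-- The throughput `∑ i |f i|` of a fractional multi-commodity flow. -/
noncomputable def mcfThroughput {ι : Type} [Fintype ι]
    (f : ι → (List (ℕ × ℕ) →₀ ℝ)) : ℝ :=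
  ∑ i, ∑ P ∈ (f i).support, f i P

/-- The path that makes `n` forward steps starting from `u`. -/
def forwardPath : ℕ → ℕ × ℕ → List (ℕ × ℕ)
  | 0, u => [u]
  | n + 1, u => u :: forwardPath n (u.1 + 1, u.2 + 1)

/-- Follow a path for `m` steps, then forward at every step up to row `b`. -/
def truncateForward (b : ℕ) : ℕ → List (ℕ × ℕ) → List (ℕ × ℕ)
  | _, [] => []
  | 0, u :: _ => forwardPath (b - u.1) u
  | m + 1, u :: L => u :: truncateForward b m L

lemma GridStep.snd_eq {u v : ℕ × ℕ} (h : GridStep u v) : v.2 = u.2 + 1 := by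
  rcases h with rfl | rfl <;> rfl

lemma GridStep.fst_le {u v : ℕ × ℕ} (h : GridStep u v) : u.1 ≤ v.1 := by
  rcases h with rfl | rfl <;> simp

lemma head?_forwardPath (n : ℕ) (u : ℕ × ℕ) : (forwardPath n u).head? = some u := by
  cases n <;> rfl

lemma length_forwardPath (n : ℕ) (u : ℕ × ℕ) : (forwardPath n u).length = n + 1 := by
  induction n generalizing u with
  | zero => rfl
  | succ n ih => simp [forwardPath, ih]

lemma isChain_cons_of_head? {u v : ℕ × ℕ} {L : List (ℕ × ℕ)} (hv : L.head? = some v)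
    (h : GridStep u v) (hL : L.IsChain GridStep) : (u :: L).IsChain GridStep := by
  cases L with
  | nil => simp
  | cons w L =>
    obtain rfl : w = v := by simpa using hv
    exact List.isChain_cons_cons.2 ⟨h, hL⟩

lemma getLast?_cons_of_head? {u v : ℕ × ℕ} {L : List (ℕ × ℕ)} (hv : L.head? = some v) :
    (u :: L).getLast? = L.getLast? := by
  cases L with
  | nil => simp at hv
  | cons w L => simp [List.getLast?_cons_cons]

lemma mem_pathEdges_cons_of_head? {u v : ℕ × ℕ} {L : List (ℕ × ℕ)} (hv : L.head? = some v)
    {e : (ℕ × ℕ) × (ℕ × ℕ)} : e ∈ pathEdges (u :: L) ↔ e = (u, v) ∨ e ∈ pathEdges L := by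
  cases L with
  | nil => simp at hv
  | cons w L =>
    obtain rfl : w = v := by simpa using hv
    exact List.mem_cons

lemma isChain_forwardPath (n : ℕ) (u : ℕ × ℕ) : (forwardPath n u).IsChain GridStep := by
  induction n generalizing u with
  | zero => simp [forwardPath]
  | succ n ih => exact isChain_cons_of_head? (head?_forwardPath _ _) (Or.inr rfl) (ih _)

lemma getLast?_forwardPath (n : ℕ) (u : ℕ × ℕ) :
    (forwardPath n u).getLast? = some (u.1 + n, u.2 + n) := by
  induction n generalizing u with
  | zero => rfl
  | succ n ih =>
    rw [forwardPath, getLast?_cons_of_head? (head?_forwardPath _ _), ih]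
    simp only [Option.some.injEq, Prod.mk.injEq]
    omega

lemma exists_of_mem_pathEdges_forwardPath {n : ℕ} {u : ℕ × ℕ} {e : (ℕ × ℕ) × (ℕ × ℕ)}
    (he : e ∈ pathEdges (forwardPath n u)) :
    ∃ k < n, e = ((u.1 + k, u.2 + k), (u.1 + k + 1, u.2 + k + 1)) := by
  induction n generalizing u with
  | zero => simp [forwardPath, pathEdges] at he
  | succ n ih =>
    rw [forwardPath, mem_pathEdges_cons_of_head? (head?_forwardPath _ _)] at he
    rcases he with rfl | he
    · exact ⟨0, by omega, rfl⟩
    · obtain ⟨k, hk, rfl⟩ := ih he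
      refine ⟨k + 1, by omega, ?_⟩
      simp only [Prod.mk.injEq]
      omega

lemma head?_truncateForward (b m : ℕ) (L : List (ℕ × ℕ)) :
    (truncateForward b m L).head? = L.head? := by
  rcases L with _ | ⟨u, L⟩ <;> cases m <;> simp [truncateForward, head?_forwardPath]

lemma fst_le_of_getLast? {u w : ℕ × ℕ} {L : List (ℕ × ℕ)}
    (hL : (u :: L).IsChain GridStep) (hw : (u :: L).getLast? = some w) : u.1 ≤ w.1 := by
  induction L generalizing u with
  | nil => simp_all
  | cons v L ih =>
    rw [List.isChain_cons_cons] at hL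
    rw [List.getLast?_cons_cons] at hw
    exact hL.1.fst_le.trans (ih hL.2 hw)

lemma isChain_truncateForward (b m : ℕ) {L : List (ℕ × ℕ)} (hL : L.IsChain GridStep) :
    (truncateForward b m L).IsChain GridStep := by
  induction m generalizing L with
  | zero =>
    cases L with
    | nil => simp [truncateForward]
    | cons u L => exact isChain_forwardPath _ _
  | succ m ih =>
    rcases L with _ | ⟨u, _ | ⟨v, L⟩⟩
    · simp [truncateForward]
    · simp [truncateForward]
    · rw [List.isChain_cons_cons] at hL
      exact isChain_cons_of_head? (head?_truncateForward _ _ _) hL.1 (ih hL.2)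

lemma getLast?_truncateForward {b s : ℕ} (m : ℕ) {L : List (ℕ × ℕ)} (hL : L.IsChain GridStep)
    (hb : L.getLast? = some (b, s)) : ∃ s', (truncateForward b m L).getLast? = some (b, s') := by
  induction m generalizing L with
  | zero =>
    cases L with
    | nil => simp at hb
    | cons u L =>
      have hu : u.1 ≤ b := fst_le_of_getLast? hL hb
      exact ⟨u.2 + (b - u.1), by
        rw [truncateForward, getLast?_forwardPath, Nat.add_sub_cancel' hu]⟩
  | succ m ih =>
    rcases L with _ | ⟨u, _ | ⟨v, L⟩⟩
    · simp at hb
    · exact ⟨s, by simpa [truncateForward] using hb⟩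
    · rw [List.isChain_cons_cons] at hL
      rw [List.getLast?_cons_cons] at hb
      rw [truncateForward, getLast?_cons_of_head? (head?_truncateForward _ _ _)]
      exact ih hL.2 hb

lemma ServesRequest.truncateForward {a b t : ℕ} {L : List (ℕ × ℕ)} (h : ServesRequest a b t L)
    (m : ℕ) : ServesRequest a b t (truncateForward b m L) := by
  obtain ⟨hL, hh, s, hs⟩ := h
  exact ⟨isChain_truncateForward b m hL, (head?_truncateForward _ _ _).trans hh,
    getLast?_truncateForward m hL hs⟩

lemma length_truncateForward_le (b m : ℕ) {u : ℕ × ℕ} {L : List (ℕ × ℕ)}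
    (hL : (u :: L).IsChain GridStep) :
    (truncateForward b m (u :: L)).length ≤ m + (b - u.1) + 1 := by
  induction m generalizing u L with
  | zero => simp [truncateForward, length_forwardPath]
  | succ m ih =>
    cases L with
    | nil => simp [truncateForward]
    | cons v L =>
      rw [List.isChain_cons_cons] at hL
      have := ih hL.2
      have := hL.1.fst_le
      rw [truncateForward, List.length_cons]
      omega

/-- An edge of the truncated path is an edge of the original path, or lies on the diagonal
through the vertex `w` at which the path is cut; the original path starts at `w` or enters it. -/
lemma mem_pathEdges_truncateForward {b m : ℕ} {u : ℕ × ℕ} {L : List (ℕ × ℕ)}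
    (hL : (u :: L).IsChain GridStep) {e : (ℕ × ℕ) × (ℕ × ℕ)}
    (he : e ∈ pathEdges (truncateForward b m (u :: L))) :
    e ∈ pathEdges (u :: L) ∨ ∃ w : ℕ × ℕ, ∃ k < b - u.1, w.2 = u.2 + m ∧
      e = ((w.1 + k, w.2 + k), (w.1 + k + 1, w.2 + k + 1)) ∧
      (m = 0 ∧ w = u ∨ ∃ x, GridStep x w ∧ (x, w) ∈ pathEdges (u :: L)) := by
  induction m generalizing u L with
  | zero =>
    obtain ⟨k, hk, rfl⟩ := exists_of_mem_pathEdges_forwardPath he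
    exact Or.inr ⟨u, k, hk, rfl, rfl, Or.inl ⟨rfl, rfl⟩⟩
  | succ m ih =>
    cases L with
    | nil => simp [truncateForward, pathEdges] at he
    | cons v L =>
      rw [List.isChain_cons_cons] at hL
      have hmem (e) : e ∈ pathEdges (u :: v :: L) ↔ e = (u, v) ∨ e ∈ pathEdges (v :: L) :=
        mem_pathEdges_cons_of_head? rfl
      have hfst := hL.1.fst_le
      have hsnd := hL.1.snd_eq
      rw [truncateForward, mem_pathEdges_cons_of_head? (head?_truncateForward _ _ _)] at he
      rcases he with rfl | he
      · exact Or.inl ((hmem _).2 (Or.inl rfl))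
      · rcases ih hL.2 he with he | ⟨w, k, hk, hw, rfl, hx⟩
        · exact Or.inl ((hmem _).2 (Or.inr he))
        · refine Or.inr ⟨w, k, by omega, by omega, rfl, Or.inr ?_⟩
          rcases hx with ⟨-, rfl⟩ | ⟨x, hx, hxe⟩
          · exact ⟨u, hL.1, (hmem _).2 (Or.inl rfl)⟩
          · exact ⟨x, hx, (hmem _).2 (Or.inr hxe)⟩

lemma ServesRequest.exists_eq_cons {a b t : ℕ} {L : List (ℕ × ℕ)} (h : ServesRequest a b t L) :
    ∃ L', L = (a, t) :: L' := by
  cases L with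
  | nil => simpa using h.2.1
  | cons u L => exact ⟨L, by simpa using h.2.1⟩

lemma ServesRequest.store_mem_of_mem_truncateForward {a b t m v τ : ℕ} {L : List (ℕ × ℕ)}
    (h : ServesRequest a b t L)
    (he : ((v, τ), (v, τ + 1)) ∈ pathEdges (_root_.truncateForward b m L)) :
    ((v, τ), (v, τ + 1)) ∈ pathEdges L := by
  obtain ⟨L, rfl⟩ := h.exists_eq_cons
  rcases mem_pathEdges_truncateForward h.1 he with he | ⟨w, k, -, -, h, -⟩
  · exact he
  · simp only [Prod.mk.injEq] at h
    omega

/-- When paths are cut at multiples of `d`, a truncated path using a given forward edge either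
used it before the truncation, or entered the one vertex at the last multiple of `d` that lies on
the diagonal of the edge. -/
lemma ServesRequest.forward_mem_of_mem_truncateForward {a b t d v τ : ℕ} {L : List (ℕ × ℕ)}
    (hd : 0 < d) (hbd : b - a ≤ d) (h : ServesRequest a b t L)
    (he : ((v, τ), (v + 1, τ + 1)) ∈ pathEdges (_root_.truncateForward b (d - t % d) L)) :
    ((v, τ), (v + 1, τ + 1)) ∈ pathEdges L ∨
      ((v - τ % d, τ - τ % d - 1), (v - τ % d, τ - τ % d - 1 + 1)) ∈ pathEdges L ∨
      ((v - τ % d - 1, τ - τ % d - 1), (v - τ % d - 1 + 1, τ - τ % d - 1 + 1)) ∈ pathEdges L := by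
  obtain ⟨L, rfl⟩ := h.exists_eq_cons
  rcases mem_pathEdges_truncateForward h.1 he with he | ⟨⟨w, s⟩, k, hk, hs, hkv, hx⟩
  · exact Or.inl he
  have hmod := Nat.mod_lt t hd
  rcases hx with ⟨h0, -⟩ | ⟨⟨x, y⟩, hstep, hx⟩
  · omega
  simp only [Prod.mk.injEq] at hkv hk hs
  have hs' : s = d * (t / d + 1) := by
    have := Nat.div_add_mod t d
    rw [mul_add]
    omega
  have hτ : τ % d = k := by
    rw [hkv.1.2, hs', Nat.mul_add_mod, Nat.mod_eq_of_lt (by omega)]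
  rw [hτ, hkv.1.1, hkv.1.2, Nat.add_sub_cancel, Nat.add_sub_cancel]
  refine Or.inr ?_
  rcases hstep with hstep | hstep <;> obtain ⟨rfl, rfl⟩ := Prod.mk.inj hstep
  · exact Or.inl hx
  · exact Or.inr hx

/-- Capacity sums and throughput of a rescaled and rerouted flow, in terms of the original one. -/
lemma sum_support_smul_mapDomain {α β : Type*} {s : ℝ} (hs : s ≠ 0) (φ : α → β) (f : α →₀ ℝ)
    (p : β → Prop) [DecidablePred p] :
    ∑ P ∈ (s • f.mapDomain φ).support, (if p P then (s • f.mapDomain φ) P else 0) =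
      s * ∑ P ∈ f.support, (if p (φ P) then f P else 0) := by
  have h := Finsupp.sum_mapDomain_index (f := φ) (s := f)
    (h := fun P x => s * if p P then x else 0) (by simp)
    (by intro P x y; split_ifs <;> simp [mul_add])
  rw [Finsupp.support_smul_eq hs, Finset.mul_sum]
  refine Eq.trans (Finset.sum_congr rfl fun P _ => ?_) h
  by_cases hp : p P <;> simp [hp]

/-- **Fractional bounded path length lemma.**  For requests of source-destination
distance at most `d`, every fractional multi-commodity flow `f` can be replaced by one
whose flow-carrying paths all have length at most `2d`, losing at most a
`c / (B + 2c)` fraction of the throughput. -/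
theorem fractional_bounded_path_length
    (B c d : ℕ) (hB : 0 < B) (hc : 0 < c) (hd : 0 < d)
    {ι : Type} [Fintype ι]
    (a b t : ι → ℕ)
    (hab : ∀ i, a i < b i) (hbd : ∀ i, b i - a i ≤ d)
    (f : ι → (List (ℕ × ℕ) →₀ ℝ))
    (hf : IsFracMCF B c a b t f) :
    ∃ g : ι → (List (ℕ × ℕ) →₀ ℝ),
      IsFracMCF B c a b t g ∧
      (∀ i P, P ∈ (g i).support → P.length - 1 ≤ 2 * d) ∧
      (c : ℝ) / (B + 2 * c) * mcfThroughput f ≤ mcfThroughput g := by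
  obtain ⟨hf0, hfs, hf1, hfB, hfc⟩ := hf
  have hB' : (0 : ℝ) < B := by exact_mod_cast hB
  have hc' : (0 : ℝ) < c := by exact_mod_cast hc
  set s : ℝ := (c : ℝ) / (B + 2 * c) with hs
  have hs0 : 0 < s := by positivity
  have hs1 : s ≤ 1 := (div_le_one (by positivity)).2 (by linarith)
  set φ : ι → List (ℕ × ℕ) → List (ℕ × ℕ) := fun i => truncateForward (b i) (d - t i % d) with hφ
  set g : ι → (List (ℕ × ℕ) →₀ ℝ) := fun i => s • (f i).mapDomain (φ i)
  have hsum (i : ι) (p : List (ℕ × ℕ) → Prop) [DecidablePred p] :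
      ∑ P ∈ (g i).support, (if p P then g i P else 0) =
        s * ∑ P ∈ (f i).support, (if p (φ i P) then f i P else 0) :=
    sum_support_smul_mapDomain hs0.ne' (φ i) (f i) p
  have htot (i : ι) : ∑ P ∈ (g i).support, g i P = s * ∑ P ∈ (f i).support, f i P := by
    simpa using hsum i fun _ => True
  have hsupp (i : ι) {P} (hP : P ∈ (g i).support) : ∃ Q ∈ (f i).support, φ i Q = P := by
    have := Finsupp.mapDomain_support (Finsupp.support_smul hP)
    simpa only [Finset.mem_image] using this
  refine ⟨g, ⟨?_, ?_, ?_, ?_, ?_⟩, ?_, ?_⟩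
  · intro i P
    have : 0 ≤ (f i).mapDomain (φ i) P := by
      rw [Finsupp.mapDomain, Finsupp.sum_apply]
      refine Finset.sum_nonneg fun Q _ => ?_
      simp only [Finsupp.single_apply]
      split_ifs
      exacts [hf0 i Q, le_rfl]
    exact mul_nonneg hs0.le this
  · intro i P hP
    obtain ⟨Q, hQ, rfl⟩ := hsupp i hP
    exact (hfs i Q hQ).truncateForward _
  · intro i
    rw [htot]
    have : 0 ≤ ∑ P ∈ (f i).support, f i P := Finset.sum_nonneg fun P _ => hf0 i P
    nlinarith [hf1 i]
  · intro v τ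
    have key : ∑ i, ∑ P ∈ (f i).support,
        (if ((v, τ), (v, τ + 1)) ∈ pathEdges (φ i P) then f i P else 0) ≤ B := by
      refine le_trans (Finset.sum_le_sum fun i _ => Finset.sum_le_sum fun P hP => ?_) (hfB v τ)
      have h0 := hf0 i P
      by_cases he : ((v, τ), (v, τ + 1)) ∈ pathEdges (φ i P)
      · rw [if_pos he, if_pos ((hfs i P hP).store_mem_of_mem_truncateForward he)]
      · rw [if_neg he]
        split_ifs <;> simp [h0]
    simp_rw [hsum, ← Finset.mul_sum]
    calc _ ≤ s * (B : ℝ) := by gcongr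
      _ ≤ B := mul_le_of_le_one_left hB'.le hs1
  · intro v τ
    have key : ∑ i, ∑ P ∈ (f i).support,
        (if ((v, τ), (v + 1, τ + 1)) ∈ pathEdges (φ i P) then f i P else 0) ≤ c + (B + c) := by
      refine le_trans ?_ (add_le_add (hfc v τ) (add_le_add
        (hfB (v - τ % d) (τ - τ % d - 1)) (hfc (v - τ % d - 1) (τ - τ % d - 1))))
      simp_rw [← Finset.sum_add_distrib]
      refine Finset.sum_le_sum fun i _ => Finset.sum_le_sum fun P hP => ?_
      have h0 := hf0 i P
      by_cases he : ((v, τ), (v + 1, τ + 1)) ∈ pathEdges (φ i P)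
      · have := (hfs i P hP).forward_mem_of_mem_truncateForward hd (hbd i) he
        rw [if_pos he]
        split_ifs <;> first | linarith | tauto
      · rw [if_neg he]
        split_ifs <;> linarith
    simp_rw [hsum, ← Finset.mul_sum]
    calc _ ≤ s * (c + (B + c) : ℝ) := by gcongr
      _ = c := by rw [hs]; field_simp; ring
  · intro i P hP
    obtain ⟨Q, hQ, rfl⟩ := hsupp i hP
    have hserve := hfs i Q hQ
    obtain ⟨L, rfl⟩ := hserve.exists_eq_cons
    have := length_truncateForward_le (b i) (d - t i % d) hserve.1
    have := hbd i
    simp only [hφ] at *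
    omega
  · simp only [mcfThroughput, htot, ← Finset.mul_sum, le_refl]
end

section
/- Let k be a positive integer and partition ℤ × ℤ into k × k tiles, assigning to each point (x, y) the tile index (⌊x/k⌋, ⌊y/k⌋). For every monotone lattice path with L edges, the number of steps of the path whose two endpoints lie in different tiles is at most ⌈L/k⌉ + 1. (Equivalently, the projection of the path to the sketch graph of tiles is a walk with at most ⌈L/k⌉ + 1 edges.) -/
/-- A step of a monotone lattice path in `ℤ × ℤ`: it adds `(1,0)` or `(0,1)`. -/
def MonoStep (u v : ℤ × ℤ) : Prop :=
  v = (u.1 + 1, u.2) ∨ v = (u.1, u.2 + 1)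

/-- The index `(⌊x/k⌋, ⌊y/k⌋)` of the `k × k` tile containing the point `(x, y)`. -/
def tileIdx (k : ℤ) (p : ℤ × ℤ) : ℤ × ℤ :=
  (Int.fdiv p.1 k, Int.fdiv p.2 k)

/-- A unit increment changes `⌊x/k⌋` by `0` or `1`. -/
theorem Int.fdiv_add_one_eq_or {k : ℤ} (hk : 0 < k) (x : ℤ) :
    Int.fdiv (x + 1) k = Int.fdiv x k ∨ Int.fdiv (x + 1) k = Int.fdiv x k + 1 := by
  simp only [Int.fdiv_eq_ediv_of_nonneg _ hk.le]
  have lower : x / k ≤ (x + 1) / k := Int.ediv_le_ediv hk (by omega)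
  have upper : (x + 1) / k ≤ (x + k) / k := Int.ediv_le_ediv hk (by omega)
  rw [Int.add_ediv_of_dvd_right (dvd_refl k), Int.ediv_self hk.ne'] at upper
  omega

/-- Along a monotone step, the sum of the tile coordinates increases by `1` if the tile
changes and by `0` otherwise. -/
theorem MonoStep.tileIdx_sum {k : ℤ} (hk : 0 < k) {u v : ℤ × ℤ} (h : MonoStep u v) :
    (tileIdx k v).1 + (tileIdx k v).2 =
      (tileIdx k u).1 + (tileIdx k u).2 + if tileIdx k u ≠ tileIdx k v then 1 else 0 := by
  obtain ⟨x, y⟩ := u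
  rcases h with rfl | rfl
  · rcases Int.fdiv_add_one_eq_or hk x with h | h <;> simp [tileIdx, h] <;> ring
  · rcases Int.fdiv_add_one_eq_or hk y with h | h <;> simp [tileIdx, h] <;> ring

/-- A monotone lattice path from `p` ends at a point `q` whose coordinate sum determines the
number of edges and whose tile coordinates determine the number of tile changes. -/
theorem exists_endpoint_of_isChain_monoStep {k : ℤ} (hk : 0 < k) (p : ℤ × ℤ)
    (l : List (ℤ × ℤ)) (h : (p :: l).IsChain MonoStep) :
    ∃ q : ℤ × ℤ, (l.length : ℤ) = q.1 + q.2 - (p.1 + p.2) ∧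
      ((((p :: l).zip l).filter fun e => tileIdx k e.1 ≠ tileIdx k e.2).length : ℤ) =
        (tileIdx k q).1 + (tileIdx k q).2 - ((tileIdx k p).1 + (tileIdx k p).2) := by
  induction l generalizing p with
  | nil => exact ⟨p, by simp⟩
  | cons r l ih =>
    obtain ⟨hpr, hl⟩ := List.isChain_cons_cons.mp h
    obtain ⟨q, hlen, hcount⟩ := ih r hl
    have hsum : r.1 + r.2 = p.1 + p.2 + 1 := by
      rcases hpr with rfl | rfl <;> ring
    have htile := hpr.tileIdx_sum hk
    refine ⟨q, by push_cast [List.length_cons]; omega, ?_⟩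
    rw [List.zip_cons_cons, List.filter_cons]
    by_cases hne : tileIdx k p = tileIdx k r
    · simp only [hne, ne_eq, not_true_eq_false, decide_false, Bool.false_eq_true, if_false]
      exact hcount
    · simp only [hne, ne_eq, not_false_eq_true, decide_true, if_true, List.length_cons] at htile ⊢
      push_cast
      simp only [ne_eq] at hcount
      rw [hcount]
      omega

/-- A monotone lattice path with `L` edges crosses between `k × k` tiles at most
`⌈L/k⌉ + 1` times; equivalently, its projection to the sketch graph of tiles is a
walk with at most `⌈L/k⌉ + 1` edges. -/
theorem sketch_path_length_bound
    (k : ℤ) (hk : 0 < k)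
    (L : List (ℤ × ℤ)) (hL : L.Chain' MonoStep) :
    (((L.zip L.tail).filter fun e => tileIdx k e.1 ≠ tileIdx k e.2).length : ℤ) ≤
      ⌈((L.length : ℚ) - 1) / (k : ℚ)⌉ + 1 := by
  have hkQ : (0 : ℚ) < k := by exact_mod_cast hk
  rcases L with _ | ⟨p, l⟩
  · have hk1 : (1 : ℚ) ≤ k := by exact_mod_cast hk
    have : (-1 : ℤ) ≤ ⌈(((0 : ℕ) : ℚ) - 1) / (k : ℚ)⌉ := by
      rw [Int.le_ceil_iff, lt_div_iff₀ hkQ]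
      push_cast
      linarith
    simp only [List.zip_nil_left, List.filter_nil, List.length_nil]
    omega
  · obtain ⟨q, hlen, hcount⟩ := exists_endpoint_of_isChain_monoStep hk p l hL
    rw [List.tail_cons, hcount]
    have hceil := Int.le_ceil ((((p :: l).length : ℚ) - 1) / (k : ℚ))
    set n := ⌈(((p :: l).length : ℚ) - 1) / (k : ℚ)⌉
    rw [div_le_iff₀ hkQ, List.length_cons] at hceil
    push_cast at hceil
    rw [add_sub_cancel_right] at hceil
    have hn : (l.length : ℤ) ≤ n * k := by exact_mod_cast hceil
    simp only [tileIdx, Int.fdiv_eq_ediv_of_nonneg _ hk.le]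
    have hq₁ := Int.ediv_mul_le q.1 hk.ne'
    have hq₂ := Int.ediv_mul_le q.2 hk.ne'
    have hp₁ := Int.lt_ediv_add_one_mul_self p.1 hk
    have hp₂ := Int.lt_ediv_add_one_mul_self p.2 hk
    refine Int.lt_add_one_iff.mp (lt_of_mul_lt_mul_right ?_ hk.le)
    linarith
end
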